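/- Let a be an odd integer with |a| > 1. Then gcd(7·k_8(a) − 1, Φ_5(a)) divides 11·151, gcd(7·k_8(a) − 1, Φ_3(a)) divides 39, and gcd(7·k_8(a) − 1, Φ_4(a)) divides 12. -/

import Mathlib

/-- `e(r,a)`: for odd prime `r` coprime to `a`, the multiplicative order of `a` modulo `r`;
for `r = 2` and odd `a`, it is `1` if `a ≡ 1 (mod 4)` and `2` if `a ≡ 3 (mod 4)`. -/
noncomputable def eOrd (r : ℕ) (a : ℤ) : ℕ :=
  if r = 2 then (if a % 4 = 1 then 1 else 2) else orderOf (a : ZMod r)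

/-- `k_i(a)`: the product, over all primitive prime divisors `r` of `a^i - 1`
(i.e. primes `r` with `e(r,a) = i`), of the `r`-part of `a^i - 1`. -/
noncomputable def kPart (i : ℕ) (a : ℤ) : ℕ :=
  ∏ r ∈ (a ^ i - 1).natAbs.primeFactors.filter (fun r => eOrd r a = i),
    r ^ (a ^ i - 1).natAbs.factorization r

lemma exists_pow_four_eq_eight_mul_add_one {a : ℤ} (ha : 1 < a.natAbs) (hodd : Odd a) :
    ∃ d : ℕ, 0 < d ∧ a ^ 4 = 8 * d + 1 := by
  obtain ⟨c, hc⟩ := hodd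
  have h4 : a ^ 4 = 8 * (2 * c ^ 4 + 4 * c ^ 3 + 3 * c ^ 2 + c) + 1 := by subst hc; ring
  have hgt : 1 < a ^ 4 := by
    have : 1 < a.natAbs ^ 4 := Nat.one_lt_pow (by norm_num) ha
    have h := Int.ofNat_lt.mpr this
    rw [Nat.cast_pow, Int.natCast_natAbs, Even.pow_abs (by decide)] at h
    simpa using h
  lift 2 * c ^ 4 + 4 * c ^ 3 + 3 * c ^ 2 + c to ℕ using by omega with d
  exact ⟨d, by omega, h4⟩

lemma orderOf_eq_eight_iff {r : ℕ} [Fact r.Prime] (hr : r ≠ 2) (x : ZMod r) :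
    orderOf x = 8 ↔ x ^ 4 = -1 := by
  have : Fact (2 < r) := ⟨lt_of_le_of_ne (Fact.out : r.Prime).two_le hr.symm⟩
  constructor
  · intro h
    have h8 : (x ^ 4) ^ 2 = 1 := by simpa [← pow_mul, h] using pow_orderOf_eq_one x
    refine (mul_self_eq_one_iff.mp (by rwa [← sq])).resolve_left ?_
    exact pow_ne_one_of_lt_orderOf (by norm_num) (by omega)
  · intro h
    refine orderOf_eq_prime_pow (p := 2) (n := 2) ?_ ?_
    · norm_num [h, ZMod.neg_one_ne_one]
    · norm_num
      rw [show 8 = 4 * 2 from rfl, pow_mul, h]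
      norm_num

lemma two_mul_kPart_eight {a : ℤ} (ha : 1 < a.natAbs) (hodd : Odd a) :
    2 * (kPart 8 a : ℤ) = a ^ 4 + 1 := by
  obtain ⟨d, hd, h4⟩ := exists_pow_four_eq_eight_mul_add_one ha hodd
  have h8 : (a ^ 8 - 1).natAbs = (4 * d + 1) * (16 * d) := by
    have : a ^ 8 - 1 = (((4 * d + 1) * (16 * d) : ℕ) : ℤ) := by
      rw [show 8 = 4 * 2 from rfl, pow_mul, h4]
      push_cast
      ring
    rw [this, Int.natAbs_natCast]
  have hcop : (4 * d + 1).Coprime (16 * d) := by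
    have h : (4 * d + 1).Coprime (4 * d) := by simp
    exact Nat.Coprime.mul_right (by simpa using (h.coprime_mul_right_right.pow_right 2))
      h.coprime_mul_left_right
  have hset : (a ^ 8 - 1).natAbs.primeFactors.filter (fun r => eOrd r a = 8)
      = (4 * d + 1).primeFactors := by
    ext r
    simp only [Finset.mem_filter, Nat.mem_primeFactors, h8]
    have key (hr : r.Prime) (hr2 : r ≠ 2) : eOrd r a = 8 ↔ r ∣ 4 * d + 1 := by
      have : Fact r.Prime := ⟨hr⟩
      rw [eOrd, if_neg hr2, orderOf_eq_eight_iff hr2, ← add_eq_zero_iff_eq_neg]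
      have hcast : (a : ZMod r) ^ 4 + 1 = ((2 * (4 * d + 1) : ℕ) : ZMod r) := by
        have := congrArg (Int.cast : ℤ → ZMod r) h4
        push_cast at this ⊢
        rw [this]
        ring
      rw [hcast, ZMod.natCast_eq_zero_iff, hr.dvd_mul, Nat.prime_dvd_prime_iff_eq hr Nat.prime_two]
      simp [hr2]
    constructor
    · rintro ⟨⟨hr, -, -⟩, he⟩
      have hr2 : r ≠ 2 := by
        rintro rfl
        unfold eOrd at he
        split_ifs at he <;> omega
      exact ⟨hr, (key hr hr2).mp he, by omega⟩
    · rintro ⟨hr, hdvd, -⟩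
      have hr2 : r ≠ 2 := by
        rintro rfl
        omega
      exact ⟨⟨hr, hdvd.mul_right _, by positivity⟩, (key hr hr2).mpr hdvd⟩
  have hk : kPart 8 a = 4 * d + 1 := by
    rw [kPart, hset, h8]
    refine (Finset.prod_congr rfl fun r hr => ?_).trans
      (Nat.prod_factorization_pow_eq_self (Nat.succ_ne_zero (4 * d)))
    rw [Nat.factorization_eq_of_coprime_left hcop
      (Nat.mem_primeFactors_iff_mem_primeFactorsList.mp hr)]
  rw [hk, h4]
  push_cast
  ring

/-- For odd `a` with `|a| > 1`: `gcd(7k_8(a)-1, Φ_5(a))` divides `11·151`,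
`gcd(7k_8(a)-1, Φ_3(a))` divides `39` and `gcd(7k_8(a)-1, Φ_4(a))` divides `12`. -/
theorem gcd_seven_k8_odd (a : ℤ) (ha : 1 < a.natAbs) (hodd : Odd a) :
    Int.gcd (7 * (kPart 8 a : ℤ) - 1) ((Polynomial.cyclotomic 5 ℤ).eval a) ∣ 11 * 151 ∧
    Int.gcd (7 * (kPart 8 a : ℤ) - 1) ((Polynomial.cyclotomic 3 ℤ).eval a) ∣ 39 ∧
    Int.gcd (7 * (kPart 8 a : ℤ) - 1) ((Polynomial.cyclotomic 4 ℤ).eval a) ∣ 12 := by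
  have hk := two_mul_kPart_eight ha hodd
  have eval_five : (Polynomial.cyclotomic 5 ℤ).eval a = a ^ 4 + a ^ 3 + a ^ 2 + a + 1 := by
    have : Fact (Nat.Prime 5) := ⟨Nat.prime_five⟩
    simp only [Polynomial.cyclotomic_prime, Finset.sum_range_succ, Finset.sum_range_zero,
      Polynomial.eval_add, Polynomial.eval_pow, Polynomial.eval_X, Polynomial.eval_zero]
    ring
  have eval_three : (Polynomial.cyclotomic 3 ℤ).eval a = a ^ 2 + a + 1 := by
    simp [Polynomial.cyclotomic_three]
  have eval_four : (Polynomial.cyclotomic 4 ℤ).eval a = a ^ 2 + 1 := by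
    rw [show 4 = 2 ^ (1 + 1) from rfl,
      Polynomial.cyclotomic_prime_pow_eq_geom_sum Nat.prime_two]
    simp [Finset.sum_range_succ, add_comm]
  rw [eval_five, eval_three, eval_four]
  generalize (kPart 8 a : ℤ) = k at hk ⊢
  have gcd_dvd {n : ℕ} (y u v : ℤ) (h : u * (7 * k - 1) + v * y = n) :
      Int.gcd (7 * k - 1) y ∣ n := by
    rw [← Int.natCast_dvd_natCast, ← h]
    exact dvd_add ((Int.gcd_dvd_left _ _).mul_left _) ((Int.gcd_dvd_right _ _).mul_left _)
  refine ⟨?_, ?_, ?_⟩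
  · refine gcd_dvd _ (2 * (-a * (125 * a ^ 3 - 50 * a ^ 2 + 195 * a - 148)))
      (625 + 7 * (a - 1) * (125 * a ^ 3 - 50 * a ^ 2 + 195 * a - 148)) ?_
    push_cast
    linear_combination 7 * (-a * (125 * a ^ 3 - 50 * a ^ 2 + 195 * a - 148)) * hk
  · refine gcd_dvd _ (2 * (-(7 * a + 2))) (49 + 7 * a * (a - 1) * (7 * a + 2)) ?_
    push_cast
    linear_combination 7 * (-(7 * a + 2)) * hk
  · refine gcd_dvd _ 2 (-7 * (a ^ 2 - 1)) ?_
    push_cast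
    linear_combination 7 * hk
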